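/- arXiv:2310.20528 — 2 statements merged into one kernel-verified Lean document; each statement's English description precedes it below -/
import Mathlib

section
/- Let ε ∈ ℝ and let (u, w) be a smooth solution of the Mikhalev system which in addition satisfies the constraint w − ε·w_x = u·(u − ε·u_x) at every point. Then m := u − ε·u_x satisfies both equations m_t = (m·u)_x and m_y = (m·w)_x everywhere. -/
/-- Partial derivative with respect to the first variable `x`. -/
noncomputable def pdx (u : ℝ → ℝ → ℝ → ℝ) (x y t : ℝ) : ℝ := deriv (fun s => u s y t) x

/-- Partial derivative with respect to the second variable `y`. -/
noncomputable def pdy (u : ℝ → ℝ → ℝ → ℝ) (x y t : ℝ) : ℝ := deriv (fun s => u x s t) y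

/-- Partial derivative with respect to the third variable `t`. -/
noncomputable def pdt (u : ℝ → ℝ → ℝ → ℝ) (x y t : ℝ) : ℝ := deriv (fun s => u x y s) t

/-- Smoothness of a function of three real variables. -/
def Smooth3 (u : ℝ → ℝ → ℝ → ℝ) : Prop :=
  ContDiff ℝ (⊤ : ℕ∞) (fun p : ℝ × ℝ × ℝ => u p.1 p.2.1 p.2.2)

/-- The Mikhalev system: `u_t = w_x` and `u_y = w_t - u w_x + w u_x`. -/
def Mikhalev (u w : ℝ → ℝ → ℝ → ℝ) : Prop :=
  ∀ x y t : ℝ,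
    pdt u x y t = pdx w x y t ∧
    pdy u x y t = pdt w x y t - u x y t * pdx w x y t + w x y t * pdx u x y t

namespace Smooth3

variable {f : ℝ → ℝ → ℝ → ℝ}

theorem hasFDerivAt (hf : Smooth3 f) (p : ℝ × ℝ × ℝ) :
    HasFDerivAt (fun p : ℝ × ℝ × ℝ => f p.1 p.2.1 p.2.2)
      (fderiv ℝ (fun p : ℝ × ℝ × ℝ => f p.1 p.2.1 p.2.2) p) p :=
  ((ContDiff.differentiable hf (by simp)) p).hasFDerivAt

theorem hasDerivAt_fderiv_x (hf : Smooth3 f) (x y t : ℝ) :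
    HasDerivAt (fun s => f s y t)
      (fderiv ℝ (fun p : ℝ × ℝ × ℝ => f p.1 p.2.1 p.2.2) (x, y, t) (1, 0, 0)) x := by
  have hc : HasDerivAt (fun s : ℝ => ((s, y, t) : ℝ × ℝ × ℝ)) (1, 0, 0) x :=
    (hasDerivAt_id x).prodMk ((hasDerivAt_const x y).prodMk (hasDerivAt_const x t))
  exact (hf.hasFDerivAt (x, y, t)).comp_hasDerivAt x hc

theorem pdx_eq_fderiv (hf : Smooth3 f) (x y t : ℝ) :
    pdx f x y t
      = fderiv ℝ (fun p : ℝ × ℝ × ℝ => f p.1 p.2.1 p.2.2) (x, y, t) (1, 0, 0) :=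
  (hf.hasDerivAt_fderiv_x x y t).deriv

theorem hasDerivAt_pdx (hf : Smooth3 f) (x y t : ℝ) :
    HasDerivAt (fun s => f s y t) (pdx f x y t) x :=
  (hf.hasDerivAt_fderiv_x x y t).differentiableAt.hasDerivAt

theorem hasDerivAt_fderiv_y (hf : Smooth3 f) (x y t : ℝ) :
    HasDerivAt (fun s => f x s t)
      (fderiv ℝ (fun p : ℝ × ℝ × ℝ => f p.1 p.2.1 p.2.2) (x, y, t) (0, 1, 0)) y := by
  have hc : HasDerivAt (fun s : ℝ => ((x, s, t) : ℝ × ℝ × ℝ)) (0, 1, 0) y :=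
    (hasDerivAt_const y x).prodMk ((hasDerivAt_id y).prodMk (hasDerivAt_const y t))
  exact (hf.hasFDerivAt (x, y, t)).comp_hasDerivAt y hc

theorem pdy_eq_fderiv (hf : Smooth3 f) (x y t : ℝ) :
    pdy f x y t
      = fderiv ℝ (fun p : ℝ × ℝ × ℝ => f p.1 p.2.1 p.2.2) (x, y, t) (0, 1, 0) :=
  (hf.hasDerivAt_fderiv_y x y t).deriv

theorem hasDerivAt_pdy (hf : Smooth3 f) (x y t : ℝ) :
    HasDerivAt (fun s => f x s t) (pdy f x y t) y :=
  (hf.hasDerivAt_fderiv_y x y t).differentiableAt.hasDerivAt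

theorem hasDerivAt_fderiv_t (hf : Smooth3 f) (x y t : ℝ) :
    HasDerivAt (fun s => f x y s)
      (fderiv ℝ (fun p : ℝ × ℝ × ℝ => f p.1 p.2.1 p.2.2) (x, y, t) (0, 0, 1)) t := by
  have hc : HasDerivAt (fun s : ℝ => ((x, y, s) : ℝ × ℝ × ℝ)) (0, 0, 1) t :=
    (hasDerivAt_const t x).prodMk ((hasDerivAt_const t y).prodMk (hasDerivAt_id t))
  exact (hf.hasFDerivAt (x, y, t)).comp_hasDerivAt t hc

theorem pdt_eq_fderiv (hf : Smooth3 f) (x y t : ℝ) :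
    pdt f x y t
      = fderiv ℝ (fun p : ℝ × ℝ × ℝ => f p.1 p.2.1 p.2.2) (x, y, t) (0, 0, 1) :=
  (hf.hasDerivAt_fderiv_t x y t).deriv

theorem hasDerivAt_pdt (hf : Smooth3 f) (x y t : ℝ) :
    HasDerivAt (fun s => f x y s) (pdt f x y t) t :=
  (hf.hasDerivAt_fderiv_t x y t).differentiableAt.hasDerivAt

theorem contDiff_fderiv (hf : Smooth3 f) :
    ContDiff ℝ (⊤ : ℕ∞) (fderiv ℝ (fun p : ℝ × ℝ × ℝ => f p.1 p.2.1 p.2.2)) :=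
  ContDiff.fderiv_right hf (by simp)

theorem smooth_pdx (hf : Smooth3 f) : Smooth3 (pdx f) := by
  unfold Smooth3
  simp only [hf.pdx_eq_fderiv]
  exact hf.contDiff_fderiv.clm_apply contDiff_const

theorem smooth_pdy (hf : Smooth3 f) : Smooth3 (pdy f) := by
  unfold Smooth3
  simp only [hf.pdy_eq_fderiv]
  exact hf.contDiff_fderiv.clm_apply contDiff_const

theorem smooth_pdt (hf : Smooth3 f) : Smooth3 (pdt f) := by
  unfold Smooth3
  simp only [hf.pdt_eq_fderiv]
  exact hf.contDiff_fderiv.clm_apply contDiff_const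

theorem fderiv_fderiv_apply (hf : Smooth3 f) (p v w : ℝ × ℝ × ℝ) :
    fderiv ℝ (fun q => fderiv ℝ (fun p : ℝ × ℝ × ℝ => f p.1 p.2.1 p.2.2) q v) p w
      = fderiv ℝ (fderiv ℝ (fun p : ℝ × ℝ × ℝ => f p.1 p.2.1 p.2.2)) p w v := by
  have h := (hf.contDiff_fderiv.differentiable (by simp) p).hasFDerivAt
  rw [(h.clm_apply (hasFDerivAt_const v p)).fderiv]
  simp

theorem fderiv_fderiv_comm (hf : Smooth3 f) (p v w : ℝ × ℝ × ℝ) :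
    fderiv ℝ (fun q => fderiv ℝ (fun p : ℝ × ℝ × ℝ => f p.1 p.2.1 p.2.2) q v) p w
      = fderiv ℝ (fun q => fderiv ℝ (fun p : ℝ × ℝ × ℝ => f p.1 p.2.1 p.2.2) q w) p v := by
  rw [hf.fderiv_fderiv_apply, hf.fderiv_fderiv_apply]
  exact (ContDiff.contDiffAt hf).isSymmSndFDerivAt
    (by
      rw [minSmoothness_of_isRCLikeNormedField]
      exact WithTop.coe_le_coe.2 (le_top : (2 : ℕ∞) ≤ ⊤)) w v

theorem pdt_pdx (hf : Smooth3 f) (x y t : ℝ) :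
    pdt (pdx f) x y t = pdx (pdt f) x y t := by
  rw [hf.smooth_pdx.pdt_eq_fderiv, hf.smooth_pdt.pdx_eq_fderiv]
  simp only [hf.pdx_eq_fderiv, hf.pdt_eq_fderiv]
  exact hf.fderiv_fderiv_comm _ _ _

theorem pdy_pdx (hf : Smooth3 f) (x y t : ℝ) :
    pdy (pdx f) x y t = pdx (pdy f) x y t := by
  rw [hf.smooth_pdx.pdy_eq_fderiv, hf.smooth_pdy.pdx_eq_fderiv]
  simp only [hf.pdx_eq_fderiv, hf.pdy_eq_fderiv]
  exact hf.fderiv_fderiv_comm _ _ _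

end Smooth3

theorem stmt_11 (ε : ℝ) (u w : ℝ → ℝ → ℝ → ℝ)
    (hu : Smooth3 u) (hw : Smooth3 w) (h : Mikhalev u w)
    (hconstraint : ∀ x y t : ℝ,
      w x y t - ε * pdx w x y t = u x y t * (u x y t - ε * pdx u x y t)) :
    ∀ x y t : ℝ,
      pdt (fun x y t => u x y t - ε * pdx u x y t) x y t
        = pdx (fun x y t => (u x y t - ε * pdx u x y t) * u x y t) x y t ∧
      pdy (fun x y t => u x y t - ε * pdx u x y t) x y t
        = pdx (fun x y t => (u x y t - ε * pdx u x y t) * w x y t) x y t := by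
  intro x y t
  have hut : pdt u = pdx w := by
    funext x y t
    exact (h x y t).1
  have huy : pdy u = fun x y t =>
      pdt w x y t - u x y t * pdx w x y t + w x y t * pdx u x y t := by
    funext x y t
    exact (h x y t).2
  have mx := (hu.hasDerivAt_pdx x y t).sub ((hu.smooth_pdx.hasDerivAt_pdx x y t).const_mul ε)
  have my := (hu.hasDerivAt_pdy x y t).sub ((hu.smooth_pdx.hasDerivAt_pdy x y t).const_mul ε)
  have mt := (hu.hasDerivAt_pdt x y t).sub ((hu.smooth_pdx.hasDerivAt_pdt x y t).const_mul ε)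
  have cx := (hw.hasDerivAt_pdx x y t).sub ((hw.smooth_pdx.hasDerivAt_pdx x y t).const_mul ε)
  have ct := (hw.hasDerivAt_pdt x y t).sub ((hw.smooth_pdx.hasDerivAt_pdt x y t).const_mul ε)
  have cx_eq := cx.unique (((hu.hasDerivAt_pdx x y t).mul mx).congr_of_eventuallyEq
    (.of_forall fun s => hconstraint s y t))
  have ct_eq := ct.unique (((hu.hasDerivAt_pdt x y t).mul mt).congr_of_eventuallyEq
    (.of_forall fun s => hconstraint x y s))
  have huyx : pdx (pdy u) x y t = pdx (pdt w) x y t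
      - (pdx u x y t * pdx w x y t + u x y t * pdx (pdx w) x y t)
      + (pdx w x y t * pdx u x y t + w x y t * pdx (pdx u) x y t) := by
    rw [huy]
    exact (((hw.smooth_pdt.hasDerivAt_pdx x y t).sub
      ((hu.hasDerivAt_pdx x y t).mul (hw.smooth_pdx.hasDerivAt_pdx x y t))).add
      ((hw.hasDerivAt_pdx x y t).mul (hu.smooth_pdx.hasDerivAt_pdx x y t))).deriv
  have hmt := hu.pdt_pdx x y t
  have hmy := hu.pdy_pdx x y t
  have hwt := hw.pdt_pdx x y t
  have h₂ := (h x y t).2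
  simp only [Pi.sub_apply] at cx_eq ct_eq
  rw [hmt, hwt, hut] at ct_eq
  constructor
  · refine mt.deriv.trans (Eq.trans ?_ (mx.mul (hu.hasDerivAt_pdx x y t)).deriv.symm)
    rw [hmt, hut]
    simp only [Pi.sub_apply]
    linear_combination cx_eq
  · refine my.deriv.trans (Eq.trans ?_ (mx.mul (hw.hasDerivAt_pdx x y t)).deriv.symm)
    rw [hmy, huyx, h₂]
    simp only [Pi.sub_apply]
    linear_combination ct_eq
end

section
/- Let ε ∈ ℝ and let (u, w) be a smooth solution of the Mikhalev system which in addition satisfies the constraint w − ε²·w_xx = u·(u − ε²·u_xx) + (1/2)·(u² − ε²·u_x²) at every point. Then n := u − ε²·u_xx satisfies both equations n_t = (n·u)_x + n·u_x and n_y = (n·w)_x + n·w_x everywhere. -/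
theorem Smooth3.pdx_eq_fderiv_s12 {u : ℝ → ℝ → ℝ → ℝ} (hu : Smooth3 u) (x y t : ℝ) :
    pdx u x y t =
      fderiv ℝ (fun p : ℝ × ℝ × ℝ => u p.1 p.2.1 p.2.2) (x, y, t) (1, 0, 0) := by
  have hF := (hu.differentiable (by simp) (x, y, t)).hasFDerivAt
  have hg : HasDerivAt (fun s : ℝ => ((s, y, t) : ℝ × ℝ × ℝ)) (1, 0, 0) x :=
    (hasDerivAt_id x).prodMk ((hasDerivAt_const x y).prodMk (hasDerivAt_const x t))
  exact (hF.comp_hasDerivAt x hg).deriv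

theorem Smooth3.pdy_eq_fderiv_s12 {u : ℝ → ℝ → ℝ → ℝ} (hu : Smooth3 u) (x y t : ℝ) :
    pdy u x y t =
      fderiv ℝ (fun p : ℝ × ℝ × ℝ => u p.1 p.2.1 p.2.2) (x, y, t) (0, 1, 0) := by
  have hF := (hu.differentiable (by simp) (x, y, t)).hasFDerivAt
  have hg : HasDerivAt (fun s : ℝ => ((x, s, t) : ℝ × ℝ × ℝ)) (0, 1, 0) y :=
    (hasDerivAt_const y x).prodMk ((hasDerivAt_id y).prodMk (hasDerivAt_const y t))
  exact (hF.comp_hasDerivAt y hg).deriv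

theorem Smooth3.pdt_eq_fderiv_s12 {u : ℝ → ℝ → ℝ → ℝ} (hu : Smooth3 u) (x y t : ℝ) :
    pdt u x y t =
      fderiv ℝ (fun p : ℝ × ℝ × ℝ => u p.1 p.2.1 p.2.2) (x, y, t) (0, 0, 1) := by
  have hF := (hu.differentiable (by simp) (x, y, t)).hasFDerivAt
  have hg : HasDerivAt (fun s : ℝ => ((x, y, s) : ℝ × ℝ × ℝ)) (0, 0, 1) t :=
    (hasDerivAt_const t x).prodMk ((hasDerivAt_const t y).prodMk (hasDerivAt_id t))
  exact (hF.comp_hasDerivAt t hg).deriv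

/-- Directional derivatives of a smooth function are smooth. -/
theorem contDiff_fderiv_apply_const {E : Type*} [NormedAddCommGroup E] [NormedSpace ℝ E]
    {F : E → ℝ} (hF : ContDiff ℝ (⊤ : ℕ∞) F) (v : E) :
    ContDiff ℝ (⊤ : ℕ∞) (fun p => fderiv ℝ F p v) :=
  (hF.fderiv_right (by simp)).clm_apply contDiff_const

/-- Directional derivatives of a smooth function commute. -/
theorem fderiv_fderiv_apply_comm {E : Type*} [NormedAddCommGroup E] [NormedSpace ℝ E]
    {F : E → ℝ} (hF : ContDiff ℝ (⊤ : ℕ∞) F) (p v w : E) :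
    fderiv ℝ (fun q => fderiv ℝ F q v) p w = fderiv ℝ (fun q => fderiv ℝ F q w) p v := by
  have hd : DifferentiableAt ℝ (fderiv ℝ F) p :=
    (hF.fderiv_right (m := (⊤ : ℕ∞)) (by simp)).differentiable (by simp) p
  have key : ∀ a b : E,
      fderiv ℝ (fun q => fderiv ℝ F q a) p b = fderiv ℝ (fderiv ℝ F) p b a := fun a b => by
    rw [fderiv_clm_apply hd (differentiableAt_const a)]
    simp
  rw [key, key]
  refine (hF.contDiffAt.isSymmSndFDerivAt ?_) w v
  rw [minSmoothness_of_isRCLikeNormedField]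
  exact WithTop.coe_le_coe.2 (le_top : (2 : ℕ∞) ≤ ⊤)

theorem Smooth3.dx {u : ℝ → ℝ → ℝ → ℝ} (hu : Smooth3 u) : Smooth3 (pdx u) := by
  simpa only [Smooth3, hu.pdx_eq_fderiv_s12] using contDiff_fderiv_apply_const hu (1, 0, 0)

theorem Smooth3.dy {u : ℝ → ℝ → ℝ → ℝ} (hu : Smooth3 u) : Smooth3 (pdy u) := by
  simpa only [Smooth3, hu.pdy_eq_fderiv_s12] using contDiff_fderiv_apply_const hu (0, 1, 0)

theorem Smooth3.dt {u : ℝ → ℝ → ℝ → ℝ} (hu : Smooth3 u) : Smooth3 (pdt u) := by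
  simpa only [Smooth3, hu.pdt_eq_fderiv_s12] using contDiff_fderiv_apply_const hu (0, 0, 1)

theorem Smooth3.pdt_pdx_s12 {u : ℝ → ℝ → ℝ → ℝ} (hu : Smooth3 u) :
    pdt (pdx u) = pdx (pdt u) := by
  funext x y t
  rw [hu.dx.pdt_eq_fderiv_s12, hu.dt.pdx_eq_fderiv_s12]
  simp only [hu.pdx_eq_fderiv_s12, hu.pdt_eq_fderiv_s12]
  exact fderiv_fderiv_apply_comm hu _ _ _

theorem Smooth3.pdy_pdx_s12 {u : ℝ → ℝ → ℝ → ℝ} (hu : Smooth3 u) :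
    pdy (pdx u) = pdx (pdy u) := by
  funext x y t
  rw [hu.dx.pdy_eq_fderiv_s12, hu.dy.pdx_eq_fderiv_s12]
  simp only [hu.pdx_eq_fderiv_s12, hu.pdy_eq_fderiv_s12]
  exact fderiv_fderiv_apply_comm hu _ _ _

theorem Smooth3.hasDerivAt_x {u : ℝ → ℝ → ℝ → ℝ} (hu : Smooth3 u) (x y t : ℝ) :
    HasDerivAt (fun s => u s y t) (pdx u x y t) x :=
  DifferentiableAt.hasDerivAt <| by
    have hd := hu.differentiable (by simp)
    exact hd.comp (g := fun p : ℝ × ℝ × ℝ => u p.1 p.2.1 p.2.2)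
      (f := fun s : ℝ => (s, y, t)) (by fun_prop) x

theorem Smooth3.hasDerivAt_y {u : ℝ → ℝ → ℝ → ℝ} (hu : Smooth3 u) (x y t : ℝ) :
    HasDerivAt (fun s => u x s t) (pdy u x y t) y :=
  DifferentiableAt.hasDerivAt <| by
    have hd := hu.differentiable (by simp)
    exact hd.comp (g := fun p : ℝ × ℝ × ℝ => u p.1 p.2.1 p.2.2)
      (f := fun s : ℝ => (x, s, t)) (by fun_prop) y

theorem Smooth3.hasDerivAt_t {u : ℝ → ℝ → ℝ → ℝ} (hu : Smooth3 u) (x y t : ℝ) :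
    HasDerivAt (fun s => u x y s) (pdt u x y t) t :=
  DifferentiableAt.hasDerivAt <| by
    have hd := hu.differentiable (by simp)
    exact hd.comp (g := fun p : ℝ × ℝ × ℝ => u p.1 p.2.1 p.2.2)
      (f := fun s : ℝ => (x, y, s)) (by fun_prop) t


theorem stmt_12 (ε : ℝ) (u w : ℝ → ℝ → ℝ → ℝ)
    (hu : Smooth3 u) (hw : Smooth3 w) (h : Mikhalev u w)
    (hconstraint : ∀ x y t : ℝ,
      w x y t - ε ^ 2 * pdx (pdx w) x y t
        = u x y t * (u x y t - ε ^ 2 * pdx (pdx u) x y t)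
          + (1 / 2) * ((u x y t) ^ 2 - ε ^ 2 * (pdx u x y t) ^ 2)) :
    ∀ x y t : ℝ,
      pdt (fun x y t => u x y t - ε ^ 2 * pdx (pdx u) x y t) x y t
        = pdx (fun x y t => (u x y t - ε ^ 2 * pdx (pdx u) x y t) * u x y t) x y t
          + (u x y t - ε ^ 2 * pdx (pdx u) x y t) * pdx u x y t ∧
      pdy (fun x y t => u x y t - ε ^ 2 * pdx (pdx u) x y t) x y t
        = pdx (fun x y t => (u x y t - ε ^ 2 * pdx (pdx u) x y t) * w x y t) x y t
          + (u x y t - ε ^ 2 * pdx (pdx u) x y t) * pdx w x y t := by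
  have hut : pdt u = pdx w := by
    funext x y t
    exact (h x y t).1
  have huy : pdy u =
      fun x y t => pdt w x y t - u x y t * pdx w x y t + w x y t * pdx u x y t := by
    funext x y t
    exact (h x y t).2
  have huxt : pdt (pdx u) = pdx (pdx w) := by rw [hu.pdt_pdx_s12, hut]
  have huxxt : pdt (pdx (pdx u)) = pdx (pdx (pdx w)) := by rw [hu.dx.pdt_pdx_s12, huxt]
  have hwxxt : pdt (pdx (pdx w)) = pdx (pdx (pdt w)) := by rw [hw.dx.pdt_pdx_s12, hw.pdt_pdx_s12]
  have huyx : pdx (pdy u) = fun x y t =>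
      pdx (pdt w) x y t - u x y t * pdx (pdx w) x y t + w x y t * pdx (pdx u) x y t := by
    funext x y t
    rw [huy]
    refine HasDerivAt.deriv ((((hw.dt.hasDerivAt_x x y t).sub
      ((hu.hasDerivAt_x x y t).mul (hw.dx.hasDerivAt_x x y t))).add
      ((hw.hasDerivAt_x x y t).mul (hu.dx.hasDerivAt_x x y t))).congr_deriv ?_)
    ring
  have huyxx (x y t : ℝ) : pdy (pdx (pdx u)) x y t =
      pdx (pdx (pdt w)) x y t
        - (pdx u x y t * pdx (pdx w) x y t + u x y t * pdx (pdx (pdx w)) x y t)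
        + (pdx w x y t * pdx (pdx u) x y t + w x y t * pdx (pdx (pdx u)) x y t) := by
    rw [hu.dx.pdy_pdx_s12, hu.pdy_pdx_s12, huyx]
    exact HasDerivAt.deriv (((hw.dt.dx.hasDerivAt_x x y t).sub
      ((hu.hasDerivAt_x x y t).mul (hw.dx.dx.hasDerivAt_x x y t))).add
      ((hw.hasDerivAt_x x y t).mul (hu.dx.dx.hasDerivAt_x x y t)))
  intro x y t
  have hnx := (hu.hasDerivAt_x x y t).sub ((hu.dx.dx.hasDerivAt_x x y t).const_mul (ε ^ 2))
  have hny := (hu.hasDerivAt_y x y t).sub ((hu.dx.dx.hasDerivAt_y x y t).const_mul (ε ^ 2))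
  have hnt := (hu.hasDerivAt_t x y t).sub ((hu.dx.dx.hasDerivAt_t x y t).const_mul (ε ^ 2))
  have hcx := ((hw.hasDerivAt_x x y t).sub
    ((hw.dx.dx.hasDerivAt_x x y t).const_mul (ε ^ 2))).unique <|
      (((hu.hasDerivAt_x x y t).mul hnx).add
        ((((hu.hasDerivAt_x x y t).pow 2).sub
          (((hu.dx.hasDerivAt_x x y t).pow 2).const_mul (ε ^ 2))).const_mul (1 / 2))
        ).congr_of_eventuallyEq (.of_forall fun s => hconstraint s y t)
  have hct := ((hw.hasDerivAt_t x y t).sub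
    ((hw.dx.dx.hasDerivAt_t x y t).const_mul (ε ^ 2))).unique <|
      (((hu.hasDerivAt_t x y t).mul hnt).add
        ((((hu.hasDerivAt_t x y t).pow 2).sub
          (((hu.dx.hasDerivAt_t x y t).pow 2).const_mul (ε ^ 2))).const_mul (1 / 2))
        ).congr_of_eventuallyEq (.of_forall fun s => hconstraint x y s)
  simp only [Pi.sub_apply, hut, huxt, huxxt, hwxxt, Nat.cast_ofNat, Nat.add_one_sub_one,
    pow_one] at hcx hct hnt
  constructor
  · refine hnt.deriv.trans ?_
    rw [show pdx (fun x y t => (u x y t - ε ^ 2 * pdx (pdx u) x y t) * u x y t) x y t = _ from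
      (hnx.mul (hu.hasDerivAt_x x y t)).deriv]
    simp only [Pi.sub_apply]
    linear_combination hcx
  · refine hny.deriv.trans ?_
    rw [show pdx (fun x y t => (u x y t - ε ^ 2 * pdx (pdx u) x y t) * w x y t) x y t = _ from
      (hnx.mul (hw.hasDerivAt_x x y t)).deriv, huyxx, (h x y t).2]
    simp only [Pi.sub_apply]
    linear_combination hct
end
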